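/- Let μ > 0, let a ∈ ℝ with a ∈ (−2μ/9, 0) ∪ (0, 4μ/9), and let s ∈ ℝ with s ≥ 2μ/3. Then β₁(a, s) = 27a²(3a − 2s)/s³ is strictly negative (in particular nonzero), and the function F(z) := H(z; s, a)/β₁(a, s), where H(z; s, a) = 27a²z(2s − 3a)/(27a³z − 27a²zs − (z−1)²s³), is holomorphic and injective on the open unit disc 𝔻 = {z ∈ ℂ : |z| < 1}, with F(0) = 0 and F'(0) = 1. Equivalently, the kernel z ↦ H(z; s, a) is univalent on 𝔻. -/

import Mathlib

/-- The crossing-symmetric dispersion kernel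
`H(z; s, a) = 27a²z(2s − 3a)/(27a³z − 27a²zs − (z−1)²s³)`. -/
noncomputable def crossingKernel (a s : ℝ) (z : ℂ) : ℂ :=
  27 * (a : ℂ) ^ 2 * z * (2 * (s : ℂ) - 3 * (a : ℂ)) /
    (27 * (a : ℂ) ^ 3 * z - 27 * (a : ℂ) ^ 2 * z * (s : ℂ)
      - (z - 1) ^ 2 * (s : ℂ) ^ 3)

open Metric

/-- A real quadratic `1 + γz + z²` with `γ ∈ [-2, 2]` has no zero in the open unit disc. -/
theorem one_add_mul_add_sq_ne_zero {γ : ℝ} (h₁ : -2 ≤ γ) (h₂ : γ ≤ 2) {z : ℂ}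
    (hz : z ∈ ball (0 : ℂ) 1) : 1 + (γ : ℂ) * z + z ^ 2 ≠ 0 := by
  intro h
  have hn : z.re * z.re + z.im * z.im < 1 := by
    rw [← Complex.normSq_apply, Complex.normSq_eq_norm_sq]
    have := mem_ball_zero_iff.mp hz
    nlinarith [norm_nonneg z]
  have hre := congrArg Complex.re h
  have him := congrArg Complex.im h
  simp [pow_two] at hre him
  have him' : z.im * (γ + 2 * z.re) = 0 := by linear_combination him
  rcases mul_eq_zero.mp him' with h0 | h0
  · rw [h0] at hre hn
    have hlt : z.re < 1 := by nlinarith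
    have hgt : -1 < z.re := by nlinarith
    rcases le_total 0 z.re with hx | hx <;> nlinarith
  · have : γ = -2 * z.re := by linarith
    subst this
    nlinarith

theorem differentiableOn_div_one_add_mul_add_sq {γ : ℝ} (h₁ : -2 ≤ γ) (h₂ : γ ≤ 2) :
    DifferentiableOn ℂ (fun z : ℂ => z / (1 + (γ : ℂ) * z + z ^ 2)) (ball 0 1) :=
  DifferentiableOn.div (by fun_prop) (by fun_prop)
    fun _ hz => one_add_mul_add_sq_ne_zero h₁ h₂ hz

theorem injOn_div_one_add_mul_add_sq {γ : ℝ} (h₁ : -2 ≤ γ) (h₂ : γ ≤ 2) :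
    Set.InjOn (fun z : ℂ => z / (1 + (γ : ℂ) * z + z ^ 2)) (ball 0 1) := by
  intro z hz w hw h
  have h' := (div_eq_div_iff (one_add_mul_add_sq_ne_zero h₁ h₂ hz)
    (one_add_mul_add_sq_ne_zero h₁ h₂ hw)).mp h
  have hprod : (z - w) * (1 - z * w) = 0 := by linear_combination h'
  rcases mul_eq_zero.mp hprod with h0 | h0
  · exact sub_eq_zero.mp h0
  · have hzw : ‖z‖ * ‖w‖ = 1 := by
      rw [← norm_mul, ← sub_eq_zero.mp h0, norm_one]
    have := mem_ball_zero_iff.mp hz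
    have := mem_ball_zero_iff.mp hw
    nlinarith [norm_nonneg z, norm_nonneg w]

theorem hasDerivAt_div_one_add_mul_add_sq_zero (γ : ℂ) :
    HasDerivAt (fun z : ℂ => z / (1 + γ * z + z ^ 2)) 1 0 := by
  have hd : HasDerivAt (fun z : ℂ => 1 + γ * z + z ^ 2) γ 0 := by
    simpa using (((hasDerivAt_id' (0 : ℂ)).const_mul γ).const_add 1).fun_add
      (hasDerivAt_pow 2 (0 : ℂ))
  simpa using (hasDerivAt_id' (0 : ℂ)).fun_div hd (by simp)

theorem crossingKernel_eq (a : ℝ) {s : ℝ} (hs : s ≠ 0) (z : ℂ) :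
    crossingKernel a s z = ((27 * a ^ 2 * (3 * a - 2 * s) / s ^ 3 : ℝ) : ℂ) *
      (z / (1 + ((27 * (a / s) ^ 2 * (1 - a / s) - 2 : ℝ) : ℂ) * z + z ^ 2)) := by
  have hs' : (s : ℂ) ≠ 0 := by exact_mod_cast hs
  have hden : 27 * (a : ℂ) ^ 3 * z - 27 * (a : ℂ) ^ 2 * z * (s : ℂ) - (z - 1) ^ 2 * (s : ℂ) ^ 3 =
      -(s : ℂ) ^ 3 * (1 + ((27 * (a / s) ^ 2 * (1 - a / s) - 2 : ℝ) : ℂ) * z + z ^ 2) := by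
    push_cast
    field_simp
    ring
  rw [crossingKernel, hden, Complex.ofReal_div, div_mul_div_comm, neg_mul, div_neg, ← neg_div]
  push_cast
  congr 1
  ring

/-- For `μ > 0`, `a ∈ (−2μ/9, 0) ∪ (0, 4μ/9)` and `s ≥ 2μ/3`, the first
Taylor coefficient `β₁(a,s) = 27a²(3a − 2s)/s³` is strictly negative, and
the normalized kernel `F = H(·; s, a)/β₁(a, s)` is a schlicht function on
the open unit disc; equivalently, the kernel `z ↦ H(z; s, a)` is univalent
on the disc. -/
theorem kernel_univalent (μ a s : ℝ) (hμ : 0 < μ)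
    (ha : a ∈ Set.Ioo (-(2 * μ) / 9) 0 ∪ Set.Ioo 0 (4 * μ / 9))
    (hs : 2 * μ / 3 ≤ s) :
    27 * a ^ 2 * (3 * a - 2 * s) / s ^ 3 < 0 ∧
    DifferentiableOn ℂ
      (fun z => crossingKernel a s z /
        ((27 * a ^ 2 * (3 * a - 2 * s) / s ^ 3 : ℝ) : ℂ)) (Metric.ball 0 1) ∧
    Set.InjOn
      (fun z => crossingKernel a s z /
        ((27 * a ^ 2 * (3 * a - 2 * s) / s ^ 3 : ℝ) : ℂ)) (Metric.ball 0 1) ∧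
    crossingKernel a s 0 / ((27 * a ^ 2 * (3 * a - 2 * s) / s ^ 3 : ℝ) : ℂ) = 0 ∧
    deriv (fun z => crossingKernel a s z /
        ((27 * a ^ 2 * (3 * a - 2 * s) / s ^ 3 : ℝ) : ℂ)) 0 = 1 ∧
    DifferentiableOn ℂ (crossingKernel a s) (Metric.ball 0 1) ∧
    Set.InjOn (crossingKernel a s) (Metric.ball 0 1) := by
  have hs0 : 0 < s := by linarith
  have ha0 : a ≠ 0 := by
    rcases ha with h | h
    exacts [h.2.ne, h.1.ne']
  have hlow : -s < 3 * a := by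
    rcases ha with h | h <;> linarith [h.1, h.2]
  have hupp : 3 * a < 2 * s := by
    rcases ha with h | h <;> linarith [h.1, h.2]
  have hβ : 27 * a ^ 2 * (3 * a - 2 * s) / s ^ 3 < 0 :=
    div_neg_of_neg_of_pos (mul_neg_of_pos_of_neg (by positivity) (by linarith)) (by positivity)
  have hβ' : ((27 * a ^ 2 * (3 * a - 2 * s) / s ^ 3 : ℝ) : ℂ) ≠ 0 := by
    exact_mod_cast hβ.ne
  have ht₁ : -1 < 3 * (a / s) := by
    rw [← mul_div_assoc, lt_div_iff₀ hs0]; linarith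
  have ht₂ : 3 * (a / s) < 2 := by
    rw [← mul_div_assoc, div_lt_iff₀ hs0]; linarith
  have hγ₁ : -2 ≤ 27 * (a / s) ^ 2 * (1 - a / s) - 2 := by
    have : 0 ≤ 27 * (a / s) ^ 2 * (1 - a / s) := mul_nonneg (by positivity) (by linarith)
    linarith
  have hγ₂ : 27 * (a / s) ^ 2 * (1 - a / s) - 2 ≤ 2 := by
    have : 0 ≤ (3 * (a / s) - 2) ^ 2 * (3 * (a / s) + 1) :=
      mul_nonneg (sq_nonneg _) (by linarith)
    linarith
  have hH := funext (crossingKernel_eq a hs0.ne')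
  have hF : (fun z => crossingKernel a s z /
      ((27 * a ^ 2 * (3 * a - 2 * s) / s ^ 3 : ℝ) : ℂ)) = fun z : ℂ =>
        z / (1 + ((27 * (a / s) ^ 2 * (1 - a / s) - 2 : ℝ) : ℂ) * z + z ^ 2) := by
    funext z
    rw [hH, mul_div_cancel_left₀ _ hβ']
  rw [hF, hH]
  have hdiff := differentiableOn_div_one_add_mul_add_sq hγ₁ hγ₂
  have hinj := injOn_div_one_add_mul_add_sq hγ₁ hγ₂
  refine ⟨hβ, hdiff, hinj, by simp, (hasDerivAt_div_one_add_mul_add_sq_zero _).deriv,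
    hdiff.const_mul _, fun z hz w hw h => hinj hz hw (mul_left_cancel₀ hβ' h)⟩
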